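/- For n ≥ 2, D(n,1) = 3^n − n − 1 − n·2^{n−1}: the number of even signed permutations of {1,...,n} with exactly one type D descent equals 3^n − n − 1 − n·2^{n−1}. -/

import Mathlib

/-- A signed permutation of `{1,...,n}` in window notation: `u i` for `i ∈ {1,...,n}`
is the `i`-th letter, with absolute values forming a permutation of `{1,...,n}`;
`u` is `0` outside `{1,...,n}`. -/
def IsSignedPerm (n : ℕ) (u : ℕ → ℤ) : Prop :=
  (∀ i ∈ Finset.Icc 1 n, 1 ≤ |u i| ∧ |u i| ≤ (n : ℤ)) ∧
  (∀ i ∈ Finset.Icc 1 n, ∀ j ∈ Finset.Icc 1 n, |u i| = |u j| → i = j) ∧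
  (∀ i, i ∉ Finset.Icc 1 n → u i = 0)

/-- An (ordinary) permutation of `{1,...,n}`, as a signed permutation with all letters positive. -/
def IsPermWord (n : ℕ) (w : ℕ → ℤ) : Prop :=
  IsSignedPerm n w ∧ ∀ i ∈ Finset.Icc 1 n, 0 < w i

/-- Number of (type A, i.e. strictly positive) descents: indices `i ∈ {1,...,n-1}` with `u i > u (i+1)`. -/
def descA (n : ℕ) (u : ℕ → ℤ) : ℕ :=
  ((Finset.Icc 1 (n - 1)).filter (fun i => u (i + 1) < u i)).card

/-- Number of type B descents: indices `i ∈ {0,...,n-1}` with `u i > u (i+1)`, where `u 0 = 0`. -/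
def descB (n : ℕ) (u : ℕ → ℤ) : ℕ :=
  ((Finset.range n).filter (fun i => u (i + 1) < u i)).card

/-- Number of type D descents: indices `i ∈ {0,...,n-1}` with `u i > u (i+1)`, where `u_0 := -u_2`. -/
def descD (n : ℕ) (u : ℕ → ℤ) : ℕ :=
  ((Finset.range n).filter (fun i => u (i + 1) < (if i = 0 then -(u 2) else u i))).card

/-- A signed permutation is even-signed if it has an even number of negative letters. -/
def IsEvenSigned (n : ℕ) (u : ℕ → ℤ) : Prop :=
  Even ((Finset.Icc 1 n).filter (fun i => u i < 0)).card

/-- Type A Eulerian number `A(n,k)`. -/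
noncomputable def eulA (n k : ℕ) : ℕ := {w : ℕ → ℤ | IsPermWord n w ∧ descA n w = k}.ncard

/-- Type B Eulerian number `B(n,k)`. -/
noncomputable def eulB (n k : ℕ) : ℕ := {u : ℕ → ℤ | IsSignedPerm n u ∧ descB n u = k}.ncard

/-- Type D Eulerian number `D(n,k)`. -/
noncomputable def eulD (n k : ℕ) : ℕ :=
  {u : ℕ → ℤ | IsSignedPerm n u ∧ IsEvenSigned n u ∧ descD n u = k}.ncard

/-- Signed permutations whose first `i` letters are positive and increasing, and whose remaining
letters are increasing. -/
def signedGrassmannian (n i : ℕ) : Set (ℕ → ℤ) :=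
  {v | IsSignedPerm n v ∧ (1 ≤ i → 0 < v 1) ∧ ∀ j ∈ Finset.Icc 1 (n - 1), j ≠ i → v j < v (j + 1)}

/-- Even signed permutations without type D descents outside `{i}`. -/
def evenDescSubset (n i : ℕ) : Set (ℕ → ℤ) :=
  {u | IsSignedPerm n u ∧ IsEvenSigned n u ∧
    ∀ j ∈ Finset.range n, u (j + 1) < (if j = 0 then -(u 2) else u j) → j = i}

/-- Change the sign of the first letter. -/
def flipFirst (u : ℕ → ℤ) : ℕ → ℤ := Function.update u 1 (-u 1)

/-- The letters `a ∈ {1,...,n}` outside `A`, negated when they belong to `N`. -/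
noncomputable def signedCompl (n : ℕ) (A N : Finset ℤ) : Finset ℤ :=
  (Finset.Icc 1 (n : ℤ) \ A).image fun a => if a ∈ N then -a else a

theorem finite_isSignedPerm (n : ℕ) : {u : ℕ → ℤ | IsSignedPerm n u}.Finite := by
  refine Set.Finite.of_injOn (f := fun (u : ℕ → ℤ) (i : Finset.Icc 1 n) => u i)
    (t := Set.univ.pi fun _ => Set.Icc (-(n : ℤ)) n) ?_ ?_ (Set.Finite.pi fun _ => Set.finite_Icc _ _)
  · intro u hu i _
    exact abs_le.mp (hu.1 i i.2).2
  · intro u hu v hv h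
    funext i
    by_cases hi : i ∈ Finset.Icc 1 n
    · exact congrFun h ⟨i, hi⟩
    · rw [hu.2.2 i hi, hv.2.2 i hi]

theorem eqOn_of_strictMonoOn_of_image_eq {u v : ℕ → ℤ} {s : Finset ℕ}
    (hu : StrictMonoOn u s) (hv : StrictMonoOn v s) (h : s.image u = s.image v) :
    Set.EqOn u v s := by
  have hu' : StrictMono fun j : s => u j := fun a b hab => hu a.2 b.2 hab
  have hv' : StrictMono fun j : s => v j := fun a b hab => hv a.2 b.2 hab
  have key : (fun j : s => u j) = fun j : s => v j := by
    refine (hu'.range_inj hv').mp ?_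
    have h' := congrArg (fun t : Finset ℤ => (t : Set ℤ)) h
    simp only [Finset.coe_image, Set.image_eq_range] at h'
    exact h'
  intro j hj
  exact congrFun key ⟨j, hj⟩

theorem exists_strictMonoOn_image_eq (T : Finset ℤ) (i m : ℕ) (hm : i + T.card = m) :
    ∃ e : ℕ → ℤ, StrictMonoOn e (Finset.Ioc i m : Finset ℕ) ∧ (Finset.Ioc i m).image e = T := by
  have mono : StrictMonoOn
      (fun j => if h : j - i - 1 < T.card then T.orderEmbOfFin rfl ⟨j - i - 1, h⟩ else 0)
      (Finset.Ioc i m : Finset ℕ) := by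
    intro a ha b hb hab
    simp only [Finset.coe_Ioc, Set.mem_Ioc] at ha hb
    have h1 : a - i - 1 < T.card := by omega
    have h2 : b - i - 1 < T.card := by omega
    simp only [h1, h2, dite_true]
    exact (T.orderEmbOfFin rfl).strictMono (Fin.mk_lt_mk.mpr (by omega))
  refine ⟨_, mono, Finset.eq_of_subset_of_card_le ?_ ?_⟩
  · intro x hx
    obtain ⟨j, hj, rfl⟩ := Finset.mem_image.mp hx
    rw [Finset.mem_Ioc] at hj
    have h1 : j - i - 1 < T.card := by omega
    simp only [h1, dite_true]
    exact Finset.orderEmbOfFin_mem ..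
  · rw [Finset.card_image_of_injOn mono.injOn, Nat.card_Ioc]
    omega

theorem strictMonoOn_Ioc {u : ℕ → ℤ} {a b : ℕ}
    (h : ∀ j, a < j → j + 1 ≤ b → u j < u (j + 1)) :
    StrictMonoOn u (Finset.Ioc a b : Finset ℕ) := by
  rw [Finset.coe_Ioc]
  exact strictMonoOn_of_lt_add_one Set.ordConnected_Ioc fun j _ hj hj' => h j hj.1 hj'.2

theorem abs_ite_neg (p : Prop) [Decidable p] (a : ℤ) : |if p then -a else a| = |a| := by
  split_ifs <;> simp

theorem injOn_ite_neg (n : ℕ) (A N : Finset ℤ) :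
    Set.InjOn (fun a : ℤ => if a ∈ N then -a else a) (Finset.Icc 1 (n : ℤ) \ A : Finset ℤ) := by
  intro a ha b hb h
  simp only [Finset.coe_sdiff, Finset.coe_Icc, Set.mem_sdiff, Set.mem_Icc] at ha hb
  have h' := congrArg abs h
  simp only [abs_ite_neg] at h'
  rwa [abs_of_pos (by omega), abs_of_pos (by omega)] at h'

theorem card_signedCompl {n : ℕ} {A : Finset ℤ} (N : Finset ℤ) (hA : A ⊆ Finset.Icc 1 (n : ℤ)) :
    (signedCompl n A N).card = n - A.card := by
  rw [signedCompl, Finset.card_image_of_injOn (injOn_ite_neg n A N),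
    Finset.card_sdiff_of_subset hA, Int.card_Icc]
  simp

section Grassmannian

variable {n i : ℕ} {v : ℕ → ℤ}

theorem strictMonoOn_head (hi : i ≤ n) (hv : v ∈ signedGrassmannian n i) :
    StrictMonoOn v (Finset.Ioc 0 i : Finset ℕ) :=
  strictMonoOn_Ioc fun j h1 h2 =>
    hv.2.2 j (Finset.mem_Icc.mpr (by omega)) (by omega)

theorem strictMonoOn_tail (hv : v ∈ signedGrassmannian n i) :
    StrictMonoOn v (Finset.Ioc i n : Finset ℕ) :=
  strictMonoOn_Ioc fun j h1 h2 =>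
    hv.2.2 j (Finset.mem_Icc.mpr (by omega)) (by omega)

theorem pos_of_mem_head (hi : i ≤ n) (hv : v ∈ signedGrassmannian n i) {j : ℕ}
    (hj : j ∈ Finset.Ioc 0 i) : 0 < v j := by
  rw [Finset.mem_Ioc] at hj
  refine (hv.2.1 (by omega)).trans_le ?_
  refine (strictMonoOn_head hi hv).monotoneOn ?_ ?_ (by omega) <;> simp <;> omega

theorem image_head_subset (hi : i ≤ n) (hv : v ∈ signedGrassmannian n i) :
    (Finset.Ioc 0 i).image v ⊆ Finset.Icc 1 (n : ℤ) := by
  intro a ha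
  obtain ⟨j, hj, rfl⟩ := Finset.mem_image.mp ha
  have hp := pos_of_mem_head hi hv hj
  rw [Finset.mem_Ioc] at hj
  have := hv.1.1 j (Finset.mem_Icc.mpr (by omega))
  rw [abs_of_pos hp] at this
  exact Finset.mem_Icc.mpr this

theorem card_image_head (hi : i ≤ n) (hv : v ∈ signedGrassmannian n i) :
    ((Finset.Ioc 0 i).image v).card = i := by
  rw [Finset.card_image_of_injOn (strictMonoOn_head hi hv).injOn, Nat.card_Ioc, Nat.sub_zero]

/-- The absolute values of the negative letters after position `i`. -/
noncomputable def negTail (n i : ℕ) (v : ℕ → ℤ) : Finset ℤ :=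
  (Finset.Icc 1 (n : ℤ)).filter fun a => -a ∈ (Finset.Ioc i n).image v

theorem abs_notMem_head (hi : i ≤ n) (hv : v ∈ signedGrassmannian n i) {j : ℕ}
    (hj : j ∈ Finset.Ioc i n) : |v j| ∉ (Finset.Ioc 0 i).image v := by
  intro h
  obtain ⟨k, hk, hkj⟩ := Finset.mem_image.mp h
  have hp := pos_of_mem_head hi hv hk
  rw [Finset.mem_Ioc] at hj hk
  have := hv.1.2.1 k (Finset.mem_Icc.mpr (by omega)) j (Finset.mem_Icc.mpr (by omega))
    (by rw [abs_of_pos hp, hkj])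
  omega

theorem image_tail_eq (hi : i ≤ n) (hv : v ∈ signedGrassmannian n i) :
    (Finset.Ioc i n).image v = signedCompl n ((Finset.Ioc 0 i).image v) (negTail n i v) := by
  refine Finset.eq_of_subset_of_card_le ?_ ?_
  · intro x hx
    obtain ⟨j, hj, rfl⟩ := Finset.mem_image.mp hx
    have hj' := Finset.mem_Ioc.mp hj
    have hjn : j ∈ Finset.Icc 1 n := Finset.mem_Icc.mpr (by omega)
    refine Finset.mem_image.mpr ⟨|v j|, Finset.mem_sdiff.mpr
      ⟨Finset.mem_Icc.mpr (hv.1.1 j hjn), abs_notMem_head hi hv hj⟩, ?_⟩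
    rcases lt_or_ge (v j) 0 with hneg | hpos
    · rw [if_pos, abs_of_neg hneg, neg_neg]
      refine Finset.mem_filter.mpr ⟨Finset.mem_Icc.mpr (hv.1.1 j hjn), ?_⟩
      rwa [abs_of_neg hneg, neg_neg]
    · rw [if_neg, abs_of_nonneg hpos]
      intro h
      obtain ⟨k, hk, hkj⟩ := Finset.mem_image.mp (Finset.mem_filter.mp h).2
      have hk' := Finset.mem_Ioc.mp hk
      have := hv.1.2.1 k (Finset.mem_Icc.mpr (by omega)) j hjn (by rw [hkj, abs_neg, abs_abs])
      subst this
      have h1 := (hv.1.1 k hjn).1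
      rw [hkj, abs_neg, abs_abs] at h1
      rw [abs_of_nonneg hpos] at h1 hkj
      omega
  · rw [card_signedCompl _ (image_head_subset hi hv), card_image_head hi hv,
      Finset.card_image_of_injOn (strictMonoOn_tail hv).injOn, Nat.card_Ioc]

theorem exists_mem_signedGrassmannian (hi : i ≤ n) {A N : Finset ℤ}
    (hA : A ⊆ Finset.Icc 1 (n : ℤ)) (hAi : A.card = i) (hN : N ⊆ Finset.Icc 1 (n : ℤ) \ A) :
    ∃ v ∈ signedGrassmannian n i, (Finset.Ioc 0 i).image v = A ∧ negTail n i v = N := by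
  obtain ⟨e, he, heA⟩ := exists_strictMonoOn_image_eq A 0 i (by omega)
  obtain ⟨f, hf, hfT⟩ := exists_strictMonoOn_image_eq (signedCompl n A N) i n
    (by rw [card_signedCompl N hA]; omega)
  let v : ℕ → ℤ := fun j => if j ∈ Finset.Ioc 0 i then e j else
    if j ∈ Finset.Ioc i n then f j else 0
  have hve : ∀ j ∈ Finset.Ioc 0 i, v j = e j := fun j hj => if_pos hj
  have hvf : ∀ j ∈ Finset.Ioc i n, v j = f j := by
    intro j hj
    rw [Finset.mem_Ioc] at hj
    simp only [v]
    rw [if_neg (by rw [Finset.mem_Ioc]; omega), if_pos (by rw [Finset.mem_Ioc]; omega)]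
  have hvA : (Finset.Ioc 0 i).image v = A := by
    rw [← heA]; exact Finset.image_congr hve
  have hvT : (Finset.Ioc i n).image v = signedCompl n A N := by
    rw [← hfT]; exact Finset.image_congr hvf
  have hsplit : Finset.Icc 1 n = Finset.Ioc 0 i ∪ Finset.Ioc i n := by
    ext j; simp only [Finset.mem_Icc, Finset.mem_union, Finset.mem_Ioc]; omega
  have habs : (Finset.Icc 1 n).image (fun j => |v j|) = Finset.Icc 1 (n : ℤ) := by
    have h1 : (Finset.Icc 1 n).image (fun j => |v j|) = ((Finset.Icc 1 n).image v).image abs := by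
      rw [Finset.image_image]; rfl
    rw [h1, hsplit, Finset.image_union, hvA, hvT, Finset.image_union, signedCompl,
      Finset.image_image]
    have h2 : ∀ s ⊆ Finset.Icc 1 (n : ℤ), ∀ g : ℤ → ℤ, (∀ a, g a = |a|) → s.image g = s := by
      intro s hs g hg
      have : Set.EqOn g id s := by
        intro a ha
        rw [hg, abs_of_pos, id]
        have := Finset.mem_Icc.mp (hs ha)
        omega
      rw [Finset.image_congr this, Finset.image_id]
    rw [h2 A hA _ fun _ => rfl,
      h2 _ Finset.sdiff_subset _ fun a => by rw [Function.comp_apply, abs_ite_neg],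
      Finset.union_sdiff_of_subset hA]
  have hinj : Set.InjOn (fun j => |v j|) (Finset.Icc 1 n : Finset ℕ) := by
    refine Finset.injOn_of_card_image_eq ?_
    rw [habs]; simp
  refine ⟨v, ⟨⟨?_, ?_, ?_⟩, ?_, ?_⟩, hvA, ?_⟩
  · intro j hj
    have : |v j| ∈ Finset.Icc 1 (n : ℤ) := habs ▸ Finset.mem_image_of_mem (fun j => |v j|) hj
    exact Finset.mem_Icc.mp this
  · exact fun a ha b hb h => hinj ha hb h
  · intro j hj
    rw [Finset.mem_Icc] at hj
    simp only [v]
    rw [if_neg (by rw [Finset.mem_Ioc]; omega), if_neg (by rw [Finset.mem_Ioc]; omega)]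
  · intro h
    have : v 1 ∈ A := hvA ▸ Finset.mem_image_of_mem v (Finset.mem_Ioc.mpr ⟨one_pos, h⟩)
    have := Finset.mem_Icc.mp (hA this)
    omega
  · intro j hj hji
    rw [Finset.mem_Icc] at hj
    rcases lt_or_gt_of_ne hji with h | h
    · have h1 : j ∈ Finset.Ioc 0 i := Finset.mem_Ioc.mpr (by omega)
      have h2 : j + 1 ∈ Finset.Ioc 0 i := Finset.mem_Ioc.mpr (by omega)
      rw [hve j h1, hve _ h2]
      exact he h1 h2 (by omega)
    · have h1 : j ∈ Finset.Ioc i n := Finset.mem_Ioc.mpr (by omega)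
      have h2 : j + 1 ∈ Finset.Ioc i n := Finset.mem_Ioc.mpr (by omega)
      rw [hvf j h1, hvf _ h2]
      exact hf h1 h2 (by omega)
  · ext a
    rw [negTail, hvT, Finset.mem_filter, signedCompl, Finset.mem_image]
    constructor
    · rintro ⟨ha, b, hb, hba⟩
      have hb := Finset.mem_Icc.mp (Finset.mem_sdiff.mp hb).1
      have ha := Finset.mem_Icc.mp ha
      by_cases hbN : b ∈ N
      · rw [if_pos hbN] at hba
        rwa [← neg_injective hba]
      · rw [if_neg hbN] at hba
        omega
    · intro ha
      exact ⟨(Finset.mem_sdiff.mp (hN ha)).1, a, hN ha, if_pos ha⟩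

theorem ncard_signedGrassmannian (hi : i ≤ n) :
    (signedGrassmannian n i).ncard = n.choose i * 2 ^ (n - i) := by
  let S : Finset (Σ _ : Finset ℤ, Finset ℤ) :=
    ((Finset.Icc 1 (n : ℤ)).powersetCard i).sigma fun A => (Finset.Icc 1 (n : ℤ) \ A).powerset
  have hS : S.card = n.choose i * 2 ^ (n - i) := by
    rw [Finset.card_sigma, Finset.sum_congr rfl (g := fun _ => 2 ^ (n - i))]
    · simp
    · intro A hA
      rw [Finset.mem_powersetCard] at hA
      rw [Finset.card_powerset, Finset.card_sdiff_of_subset hA.1, hA.2]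
      simp
  rw [← hS, ← Set.ncard_coe_finset]
  refine Set.ncard_congr (fun v _ => ⟨(Finset.Ioc 0 i).image v, negTail n i v⟩) ?_ ?_ ?_
  · intro v hv
    refine Finset.mem_coe.mpr (Finset.mem_sigma.mpr ⟨Finset.mem_powersetCard.mpr
      ⟨image_head_subset hi hv, card_image_head hi hv⟩, Finset.mem_powerset.mpr ?_⟩)
    intro a ha
    obtain ⟨ha1, ha2⟩ := Finset.mem_filter.mp ha
    refine Finset.mem_sdiff.mpr ⟨ha1, ?_⟩
    obtain ⟨j, hj, hja⟩ := Finset.mem_image.mp ha2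
    have := abs_notMem_head hi hv hj
    rwa [hja, abs_neg, abs_of_pos] at this
    have := Finset.mem_Icc.mp ha1
    omega
  · intro v w hv hw h
    simp only [Sigma.mk.injEq, heq_eq_eq] at h
    have h1 := eqOn_of_strictMonoOn_of_image_eq (strictMonoOn_head hi hv)
      (strictMonoOn_head hi hw) h.1
    have h2 := eqOn_of_strictMonoOn_of_image_eq (strictMonoOn_tail hv)
      (strictMonoOn_tail hw) (by rw [image_tail_eq hi hv, image_tail_eq hi hw, h.1, h.2])
    funext j
    by_cases hj1 : j ∈ Finset.Ioc 0 i
    · exact h1 hj1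
    by_cases hj2 : j ∈ Finset.Ioc i n
    · exact h2 hj2
    rw [Finset.mem_Ioc] at hj1 hj2
    rw [hv.1.2.2 j (by rw [Finset.mem_Icc]; omega), hw.1.2.2 j (by rw [Finset.mem_Icc]; omega)]
  · rintro ⟨A, N⟩ h
    obtain ⟨hA, hN⟩ := Finset.mem_sigma.mp (Finset.mem_coe.mp h)
    rw [Finset.mem_powersetCard] at hA
    obtain ⟨v, hv, rfl, rfl⟩ := exists_mem_signedGrassmannian hi hA.1 hA.2
      (Finset.mem_powerset.mp hN)
    exact ⟨v, hv, rfl⟩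

end Grassmannian

section Flip

variable {n : ℕ} {u : ℕ → ℤ}

@[simp] theorem flipFirst_one (u : ℕ → ℤ) : flipFirst u 1 = -u 1 := Function.update_self ..

theorem flipFirst_of_ne {j : ℕ} (hj : j ≠ 1) (u : ℕ → ℤ) : flipFirst u j = u j :=
  Function.update_of_ne hj ..

@[simp] theorem flipFirst_flipFirst (u : ℕ → ℤ) : flipFirst (flipFirst u) = u := by
  simp [flipFirst]

theorem abs_flipFirst (u : ℕ → ℤ) (j : ℕ) : |flipFirst u j| = |u j| := by
  by_cases hj : j = 1
  · rw [hj, flipFirst_one, abs_neg]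
  · rw [flipFirst_of_ne hj]

theorem IsSignedPerm.flipFirst (hu : IsSignedPerm n u) : IsSignedPerm n (flipFirst u) := by
  refine ⟨?_, ?_, ?_⟩
  · simpa only [abs_flipFirst] using hu.1
  · simpa only [abs_flipFirst] using hu.2.1
  · intro j hj
    rw [← abs_eq_zero, abs_flipFirst, abs_eq_zero]
    exact hu.2.2 j hj

theorem isEvenSigned_flipFirst (hn : 1 ≤ n) (hu : IsSignedPerm n u) :
    IsEvenSigned n (flipFirst u) ↔ ¬ IsEvenSigned n u := by
  have hsplit : Finset.Icc 1 n = insert 1 (Finset.Ioc 1 n) := by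
    ext j; simp only [Finset.mem_Icc, Finset.mem_insert, Finset.mem_Ioc]; omega
  have htail : (Finset.Ioc 1 n).filter (fun j => flipFirst u j < 0)
      = (Finset.Ioc 1 n).filter (fun j => u j < 0) := by
    refine Finset.filter_congr fun j hj => ?_
    rw [flipFirst_of_ne (by have := Finset.mem_Ioc.mp hj; omega)]
  have h1 := (hu.1 1 (Finset.mem_Icc.mpr ⟨le_rfl, hn⟩)).1
  rw [IsEvenSigned, IsEvenSigned, hsplit, Finset.filter_insert, Finset.filter_insert, htail,
    flipFirst_one]
  rcases lt_trichotomy (u 1) 0 with h | h | h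
  · rw [if_neg (by omega), if_pos h, Finset.card_insert_of_notMem (by simp), Nat.even_add_one,
      not_not]
  · simp [h] at h1
  · rw [if_pos (by omega), if_neg (by omega), Finset.card_insert_of_notMem (by simp),
      Nat.even_add_one]

end Flip

section TypeD

variable {n i : ℕ} {u : ℕ → ℤ}

theorem IsSignedPerm.ne_and_ne_neg (hu : IsSignedPerm n u) {j k : ℕ} (hj : j ∈ Finset.Icc 1 n)
    (hk : k ∈ Finset.Icc 1 n) (h : j ≠ k) : u j ≠ u k ∧ u j ≠ -u k :=
  ⟨fun e => h (hu.2.1 j hj k hk (by rw [e])),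
    fun e => h (hu.2.1 j hj k hk (by rw [e, abs_neg]))⟩

/-- The absence of type D descents outside `{i}`, in terms of the individual inequalities. -/
theorem typeD_descents_subset_iff (hn : 2 ≤ n) (hu : IsSignedPerm n u) :
    (∀ j ∈ Finset.range n, u (j + 1) < (if j = 0 then -(u 2) else u j) → j = i) ↔
      (i ≠ 0 → -u 2 < u 1) ∧ ∀ j ∈ Finset.Icc 1 (n - 1), j ≠ i → u j < u (j + 1) := by
  constructor
  · intro h
    constructor
    · intro hi
      have h0 := h 0 (Finset.mem_range.mpr (by omega))
      have := (hu.ne_and_ne_neg (j := 1) (k := 2) (Finset.mem_Icc.mpr (by omega))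
        (Finset.mem_Icc.mpr (by omega)) (by omega)).2
      simp only [if_true, zero_add] at h0
      omega
    · intro j hj hji
      rw [Finset.mem_Icc] at hj
      have h0 := h j (Finset.mem_range.mpr (by omega))
      rw [if_neg (by omega)] at h0
      have := (hu.ne_and_ne_neg (j := j) (k := j + 1) (Finset.mem_Icc.mpr (by omega))
        (Finset.mem_Icc.mpr (by omega)) (by omega)).1
      omega
  · rintro ⟨h0, h⟩ j hj hlt
    rw [Finset.mem_range] at hj
    by_contra hji
    by_cases hj0 : j = 0
    · subst hj0
      have := h0 (Ne.symm hji)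
      simp only [if_true, zero_add] at hlt
      omega
    · rw [if_neg hj0] at hlt
      have := h j (Finset.mem_Icc.mpr (by omega)) hji
      omega

theorem mem_evenDescSubset_iff (hn : 2 ≤ n) : u ∈ evenDescSubset n i ↔
    IsSignedPerm n u ∧ IsEvenSigned n u ∧ (i ≠ 0 → -u 2 < u 1) ∧
      ∀ j ∈ Finset.Icc 1 (n - 1), j ≠ i → u j < u (j + 1) :=
  and_congr_right fun hu => and_congr_right fun _ => typeD_descents_subset_iff hn hu

theorem ncard_evenDescSubset (hn : 2 ≤ n) (hi2 : 2 ≤ i) (hi : i ≤ n) :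
    (evenDescSubset n i).ncard = n.choose i * 2 ^ (n - i) := by
  rw [← ncard_signedGrassmannian hi]
  have ne_zero : ∀ {u : ℕ → ℤ}, IsSignedPerm n u → u 1 ≠ 0 := by
    intro u hu h
    have := (hu.1 1 (Finset.mem_Icc.mpr (by omega))).1
    simp [h] at this
  have one_mem : 1 ∈ Finset.Icc 1 (n - 1) := Finset.mem_Icc.mpr (by omega)
  have flip_lt : ∀ {u : ℕ → ℤ}, -u 2 < u 1 →
      (∀ j ∈ Finset.Icc 1 (n - 1), j ≠ i → u j < u (j + 1)) →
      -flipFirst u 2 < flipFirst u 1 ∧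
      ∀ j ∈ Finset.Icc 1 (n - 1), j ≠ i → flipFirst u j < flipFirst u (j + 1) := by
    intro u h1 h2
    have h12 := h2 1 one_mem (by omega)
    rw [flipFirst_of_ne (by omega), flipFirst_one]
    refine ⟨by simpa using h12, fun j hj hji => ?_⟩
    have hj' := Finset.mem_Icc.mp hj
    rw [flipFirst_of_ne (by omega : j + 1 ≠ 1)]
    by_cases h : j = 1
    · subst h
      rw [flipFirst_one]
      exact neg_lt.mp h1
    · rw [flipFirst_of_ne h]
      exact h2 j hj hji
  refine Set.ncard_congr (fun u _ => if 0 < u 1 then u else flipFirst u) ?_ ?_ ?_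
  · intro u hu
    obtain ⟨hp, -, h1, h2⟩ := (mem_evenDescSubset_iff hn).mp hu
    have h0 := ne_zero hp
    by_cases h : 0 < u 1
    · simp only [if_pos h]
      exact ⟨hp, fun _ => h, h2⟩
    · simp only [if_neg h]
      refine ⟨hp.flipFirst, fun _ => ?_, (flip_lt (h1 (by omega)) h2).2⟩
      rw [flipFirst_one]
      omega
  · intro u w hu hw h
    have hpu := isEvenSigned_flipFirst (by omega) hu.1
    have hpw := isEvenSigned_flipFirst (by omega) hw.1
    have heu := hu.2.1
    have hew := hw.2.1
    split_ifs at h with h1 h2 h2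
    · exact h
    · rw [h] at heu
      exact absurd hew (hpw.mp heu)
    · rw [← h] at hew
      exact absurd heu (hpu.mp hew)
    · rw [← flipFirst_flipFirst u, h, flipFirst_flipFirst]
  · rintro v ⟨hp, h0, h2⟩
    have hpos := h0 (by omega)
    have h12 := h2 1 one_mem (by omega)
    have h1 : -v 2 < v 1 := by
      norm_num at h12
      omega
    by_cases he : IsEvenSigned n v
    · exact ⟨v, (mem_evenDescSubset_iff hn).mpr ⟨hp, he, fun _ => h1, h2⟩, if_pos hpos⟩
    · refine ⟨flipFirst v, (mem_evenDescSubset_iff hn).mpr ⟨hp.flipFirst,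
        (isEvenSigned_flipFirst (by omega) hp).mpr he, fun _ => (flip_lt h1 h2).1,
        (flip_lt h1 h2).2⟩, ?_⟩
      rw [if_neg (by rw [flipFirst_one]; omega), flipFirst_flipFirst]

theorem ncard_evenDescSubset_zero_add_one (hn : 2 ≤ n) :
    (evenDescSubset n 0).ncard + (evenDescSubset n 1).ncard = 2 ^ n := by
  have hfin : (signedGrassmannian n 0).Finite :=
    (finite_isSignedPerm n).subset fun u hu => hu.1
  have h0 : evenDescSubset n 0 = signedGrassmannian n 0 ∩ {u | IsEvenSigned n u} := by
    ext u
    rw [mem_evenDescSubset_iff hn]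
    simp only [signedGrassmannian, Set.mem_inter_iff, Set.mem_ofPred_eq]
    constructor
    · rintro ⟨a, b, -, c⟩
      exact ⟨⟨a, by omega, c⟩, b⟩
    · rintro ⟨⟨a, -, c⟩, b⟩
      exact ⟨a, b, by omega, c⟩
  have cond : ∀ u : ℕ → ℤ,
      ((1 ≠ 0 → -u 2 < u 1) ∧ ∀ j ∈ Finset.Icc 1 (n - 1), j ≠ 1 → u j < u (j + 1)) ↔
      ∀ j ∈ Finset.Icc 1 (n - 1), j ≠ 0 → flipFirst u j < flipFirst u (j + 1) := by
    intro u
    constructor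
    · rintro ⟨h1, h2⟩ j hj hj0
      rw [flipFirst_of_ne (by omega : j + 1 ≠ 1)]
      by_cases h : j = 1
      · subst h
        rw [flipFirst_one]
        exact neg_lt.mp (h1 one_ne_zero)
      · rw [flipFirst_of_ne h]
        exact h2 j hj h
    · intro h
      refine ⟨fun _ => ?_, fun j hj hj1 => ?_⟩
      · have := h 1 (Finset.mem_Icc.mpr (by omega)) one_ne_zero
        rw [flipFirst_one, flipFirst_of_ne (by omega)] at this
        exact neg_lt.mp this
      · have hj' := Finset.mem_Icc.mp hj
        have := h j hj (by omega)
        rwa [flipFirst_of_ne hj1, flipFirst_of_ne (by omega)] at this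
  have h1 : (evenDescSubset n 1).ncard
      = (signedGrassmannian n 0 \ {u | IsEvenSigned n u}).ncard := by
    refine Set.ncard_congr (fun u _ => flipFirst u) ?_ ?_ ?_
    · intro u hu
      obtain ⟨hp, he, h⟩ := (mem_evenDescSubset_iff hn).mp hu
      refine ⟨⟨hp.flipFirst, by omega, (cond u).mp h⟩, fun h' => ?_⟩
      exact (isEvenSigned_flipFirst (by omega) hp).mp h' he
    · intro u w _ _ h
      exact Function.Involutive.injective flipFirst_flipFirst h
    · rintro v ⟨⟨hp, -, h⟩, he⟩
      refine ⟨flipFirst v, (mem_evenDescSubset_iff hn).mpr ⟨hp.flipFirst,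
        (isEvenSigned_flipFirst (by omega) hp).mpr he, (cond _).mpr ?_⟩, flipFirst_flipFirst v⟩
      rwa [flipFirst_flipFirst]
  rw [h0, h1, Set.ncard_inter_add_ncard_sdiff_eq_ncard _ _ hfin,
    ncard_signedGrassmannian (Nat.zero_le n)]
  simp

theorem card_filter_subset_singleton (n : ℕ) {s : Finset ℕ} (hs : s ⊆ Finset.range n) :
    ((Finset.range n).filter fun i => ∀ j ∈ s, j = i).card
      = (if s.card = 1 then 1 else 0) + n * (if s.card = 0 then 1 else 0) := by
  rcases s.eq_empty_or_nonempty with rfl | ⟨a, ha⟩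
  · simp
  have h0 : s.card ≠ 0 := Finset.card_ne_zero_of_mem ha
  rw [if_neg h0, mul_zero, add_zero]
  split_ifs with h1
  · obtain ⟨b, rfl⟩ := Finset.card_eq_one.mp h1
    rw [Finset.card_eq_one]
    refine ⟨b, ?_⟩
    have hb : b < n := Finset.mem_range.mp (hs (Finset.mem_singleton_self b))
    ext i
    simp only [Finset.mem_filter, Finset.mem_range, Finset.mem_singleton, forall_eq]
    omega
  · rw [Finset.card_eq_zero, Finset.filter_eq_empty_iff]
    intro i _ hall
    exact h1 (Finset.card_eq_one.mpr ⟨i, Finset.eq_singleton_iff_unique_mem.mpr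
      ⟨hall a ha ▸ ha, hall⟩⟩)

theorem sum_ncard_evenDescSubset (n : ℕ) :
    ∑ i ∈ Finset.range n, (evenDescSubset n i).ncard
      = eulD n 1 + n * (evenDescSubset n n).ncard := by
  have hfin : {u : ℕ → ℤ | IsSignedPerm n u ∧ IsEvenSigned n u}.Finite :=
    (finite_isSignedPerm n).subset fun u hu => hu.1
  let D : (ℕ → ℤ) → Finset ℕ := fun u =>
    (Finset.range n).filter fun i => u (i + 1) < (if i = 0 then -(u 2) else u i)
  have ncard_eq : ∀ (p : (ℕ → ℤ) → Prop) [DecidablePred p],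
      {u | IsSignedPerm n u ∧ IsEvenSigned n u ∧ p u}.ncard
        = ∑ u ∈ hfin.toFinset, if p u then 1 else 0 := by
    intro p _
    rw [← Finset.card_filter, ← Set.ncard_coe_finset]
    congr 1
    ext u
    simp [and_assoc]
  have hE : ∀ i, (evenDescSubset n i).ncard
      = ∑ u ∈ hfin.toFinset, if ∀ j ∈ D u, j = i then 1 else 0 := by
    intro i
    rw [← ncard_eq fun u => ∀ j ∈ D u, j = i]
    simp only [evenDescSubset, D, Finset.mem_filter, and_imp]
  have hEn : (evenDescSubset n n).ncard
      = ∑ u ∈ hfin.toFinset, if (D u).card = 0 then 1 else 0 := by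
    rw [hE]
    refine Finset.sum_congr rfl fun u _ => if_congr ?_ rfl rfl
    rw [Finset.card_eq_zero, Finset.eq_empty_iff_forall_notMem]
    refine forall_congr' fun j => ⟨fun h hj => ?_, fun h hj => absurd hj h⟩
    have hjn : j < n := Finset.mem_range.mp (Finset.mem_filter.mp hj).1
    exact hjn.ne (h hj)
  have hD : eulD n 1 = ∑ u ∈ hfin.toFinset, if (D u).card = 1 then 1 else 0 :=
    ncard_eq fun u => (D u).card = 1
  rw [hEn, hD, Finset.mul_sum, ← Finset.sum_add_distrib, Finset.sum_congr rfl fun i _ => hE i,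
    Finset.sum_comm]
  refine Finset.sum_congr rfl fun u _ => ?_
  rw [← Finset.card_filter]
  exact card_filter_subset_singleton n (Finset.filter_subset _ _)

end TypeD

/-- For `n ≥ 2`, the number of even signed permutations of `{1,...,n}` with exactly one
type D descent is `3^n − n − 1 − n·2^{n−1}`. -/
theorem eulD_one (n : ℕ) (hn : 2 ≤ n) :
    (eulD n 1 : ℤ) = 3 ^ n - n - 1 - n * 2 ^ (n - 1) := by
  have hsum := sum_ncard_evenDescSubset n
  have hlast := ncard_evenDescSubset hn hn le_rfl
  have hfirst := ncard_evenDescSubset_zero_add_one hn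
  have hbinom : ∑ i ∈ Finset.range (n + 1), n.choose i * 2 ^ (n - i) = 3 ^ n := by
    have := add_pow 1 2 n
    simp only [one_pow, one_mul] at this
    rw [show (1 : ℕ) + 2 = 3 from rfl] at this
    rw [this]
    exact Finset.sum_congr rfl fun i _ => mul_comm _ _
  obtain ⟨m, rfl⟩ := Nat.exists_eq_add_of_le' hn
  have hmid : ∑ i ∈ Finset.range m, (evenDescSubset (m + 2) (i + 1 + 1)).ncard
      = ∑ i ∈ Finset.range m, (m + 2).choose (i + 1 + 1) * 2 ^ (m + 2 - (i + 1 + 1)) :=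
    Finset.sum_congr rfl fun i hi => ncard_evenDescSubset hn (by omega)
      (by have := Finset.mem_range.mp hi; omega)
  rw [Finset.sum_range_succ', Finset.sum_range_succ', hmid] at hsum
  rw [Finset.sum_range_succ, Finset.sum_range_succ', Finset.sum_range_succ'] at hbinom
  rw [hlast] at hsum
  simp only [Nat.choose_self, Nat.sub_self, pow_zero, mul_one, zero_add, Nat.choose_zero_right,
    Nat.choose_one_right, Nat.sub_zero, one_mul] at hsum hbinom
  have e : m + 2 - 1 = m + 1 := rfl
  rw [e] at hbinom ⊢
  zify at hsum hbinom hfirst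
  push_cast at hsum hbinom hfirst ⊢
  linarith
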